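/- arXiv:1303.7114 — 2 statements merged into one kernel-verified Lean document; each statement's English description precedes it below -/
import Mathlib

section
/- If f ∈ ℚ[x,y] is homogeneous and factorizes over ℝ as f = g₁^d, where g₁ ∈ ℝ[x,y] is a polynomial of degree 1 and d > 1, then f factorizes as f = a·(g₁′)^d, where g₁′ ∈ ℚ[x,y] is a polynomial of degree 1 and a ∈ ℚ. -/
theorem aux_totalDegree_pow (g : MvPolynomial (Fin 2) ℝ) (hg : g ≠ 0) (d : ℕ) :
    (g ^ d).totalDegree = d * g.totalDegree := by
  induction d with
  | zero => simp
  | succ k ih =>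
    rw [pow_succ, MvPolynomial.totalDegree_mul_of_isDomain (pow_ne_zero _ hg) hg, ih]
    ring

open MvPolynomial in
theorem aux_linear (f : MvPolynomial (Fin 2) ℚ) (m : ℕ) (hf : f.IsHomogeneous m)
    (d : ℕ) (hd : 1 < d)
    (g₁ : MvPolynomial (Fin 2) ℝ) (hg₁ : g₁.totalDegree = 1)
    (hfact : f.map (algebraMap ℚ ℝ) = g₁ ^ d) :
    ∃ α β : ℝ, g₁ = C α * X 0 + C β * X 1 := by
  have hg0 : g₁ ≠ 0 := by rintro rfl; simp at hg₁
  have hF := hf.map (algebraMap ℚ ℝ)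
  rw [hfact] at hF
  have hm : m = d := by
    rw [← hF.totalDegree (pow_ne_zero _ hg0), aux_totalDegree_pow _ hg0, hg₁, mul_one]
  have hc : coeff 0 g₁ = 0 := by
    have h1 : coeff 0 (g₁ ^ d) = 0 := hF.coeff_eq_zero (by simp; omega)
    rw [← constantCoeff_eq, map_pow] at h1
    rw [← constantCoeff_eq]
    exact pow_eq_zero_iff (by omega) |>.1 h1
  have hs := sum_homogeneousComponent g₁
  rw [hg₁, Finset.sum_range_succ, Finset.sum_range_one, homogeneousComponent_zero, hc,
    map_zero, zero_add] at hs
  have h1 : g₁ ∈ homogeneousSubmodule (Fin 2) ℝ 1 := by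
    rw [← hs]; exact homogeneousComponent_isHomogeneous _ _
  rw [homogeneousSubmodule_one_eq_span_X, Submodule.mem_span_range_iff_exists_fun] at h1
  obtain ⟨c, hc⟩ := h1
  refine ⟨c 0, c 1, ?_⟩
  rw [← hc, Fin.sum_univ_two, smul_eq_C_mul, smul_eq_C_mul]

open MvPolynomial in
theorem aux_eval (f : MvPolynomial (Fin 2) ℚ) (v : Fin 2 → ℚ) :
    eval (fun i => (v i : ℝ)) (f.map (algebraMap ℚ ℝ)) = ((eval v f : ℚ) : ℝ) := by
  have := map_eval (algebraMap ℚ ℝ) v f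
  simpa [Function.comp_def] using this.symm

/-- if a homogeneous `f ∈ ℚ[x,y]` factorizes over `ℝ` as `g₁^d` with
`g₁` of degree `1` and `d > 1`, then `f = a·(g₁′)^d` with `a ∈ ℚ` and `g₁′ ∈ ℚ[x,y]`
of degree `1`. -/
theorem rational_factorization_of_power_of_linear
    (f : MvPolynomial (Fin 2) ℚ) (m : ℕ) (hf : f.IsHomogeneous m)
    (d : ℕ) (hd : 1 < d)
    (g₁ : MvPolynomial (Fin 2) ℝ) (hg₁ : g₁.totalDegree = 1)
    (hfact : f.map (algebraMap ℚ ℝ) = g₁ ^ d) :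
    ∃ (a : ℚ) (g₁' : MvPolynomial (Fin 2) ℚ),
      g₁'.totalDegree = 1 ∧ f = MvPolynomial.C a * g₁' ^ d := by
  obtain ⟨α, β, rfl⟩ := aux_linear f m hf d hd g₁ hg₁ hfact
  have hinj := MvPolynomial.map_injective (σ := Fin 2) (algebraMap ℚ ℝ)
    (algebraMap ℚ ℝ).injective
  by_cases hα : α = 0
  · subst hα
    have h := aux_eval f ![0, 1]
    rw [hfact] at h
    simp at h
    refine ⟨MvPolynomial.eval ![0, 1] f, MvPolynomial.X 1, by simp, hinj ?_⟩
    rw [hfact]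
    simp [← h, mul_pow]
  · have h := aux_eval f ![1, 0]
    rw [hfact] at h
    simp at h
    have h' := aux_eval (MvPolynomial.pderiv 1 f) ![1, 0]
    rw [← MvPolynomial.pderiv_map, hfact, MvPolynomial.pderiv_pow] at h'
    simp [MvPolynomial.pderiv_X] at h'
    set a := MvPolynomial.eval ![1, 0] f
    set b := MvPolynomial.eval ![1, 0] (MvPolynomial.pderiv 1 f)
    have hd0 : (d : ℝ) ≠ 0 := by positivity
    have hq : β = α * ((b / (d * a) : ℚ) : ℝ) := by
      push_cast
      rw [← h, ← h']
      obtain ⟨k, rfl⟩ : ∃ k, d = k + 1 := ⟨d - 1, by omega⟩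
      simp only [Nat.add_sub_cancel]
      field_simp
      ring
    set q := b / (d * a)
    refine ⟨a, MvPolynomial.X 0 + MvPolynomial.C q * MvPolynomial.X 1, ?_, hinj ?_⟩
    · refine MvPolynomial.IsHomogeneous.totalDegree
        ((MvPolynomial.isHomogeneous_X _ _).add (MvPolynomial.isHomogeneous_C_mul_X _ _)) ?_
      intro h0
      have := congrArg (MvPolynomial.eval ![1, 0]) h0
      simp at this
    · rw [hfact]
      simp [← h]
      rw [← mul_pow, hq]
      simp
      ring
end

section
/- If f ∈ ℚ[x,y] is homogeneous and factorizes over ℝ as f = g₁·g₂^d, where g₁, g₂ ∈ ℝ[x,y] are polynomials of degree 1 and d > 1, then f factorizes as f = a·g₁′·(g₂′)^d, where g₁′, g₂′ ∈ ℚ[x,y] are polynomials of degree 1 and a ∈ ℚ. -/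
open MvPolynomial in
lemma aux_top {φ ψ : MvPolynomial (Fin 2) ℝ} {a b : ℕ} (ha : φ.totalDegree ≤ a)
    (hb : ψ.totalDegree ≤ b) :
    homogeneousComponent (a + b) (φ * ψ)
      = homogeneousComponent a φ * homogeneousComponent b ψ := by
  classical
  ext n
  by_cases hn : n.degree = a + b
  · rw [coeff_homogeneousComponent, if_pos hn, coeff_mul, coeff_mul]
    refine Finset.sum_congr rfl ?_
    rintro ⟨i, j⟩ hij
    rw [Finset.HasAntidiagonal.mem_antidiagonal] at hij
    replace hij : i + j = n := hij
    have hdeg : i.degree + j.degree = a + b := by rw [← hn, ← hij]; simp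
    simp only [coeff_homogeneousComponent]
    rcases lt_trichotomy i.degree a with h | h | h
    · have : coeff j ψ = 0 := coeff_eq_zero_of_totalDegree_lt (by
        rw [← Finsupp.degree_apply]; omega)
      simp [this]
    · simp [h, show j.degree = b by omega]
    · have : coeff i φ = 0 := coeff_eq_zero_of_totalDegree_lt (by
        rw [← Finsupp.degree_apply]; omega)
      simp [this]
  · rw [coeff_homogeneousComponent, if_neg hn]
    exact (((homogeneousComponent_isHomogeneous a φ).mul
      (homogeneousComponent_isHomogeneous b ψ)).coeff_eq_zero hn).symm

open MvPolynomial in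
lemma aux_top_pow {ψ : MvPolynomial (Fin 2) ℝ} (hb : ψ.totalDegree ≤ 1) (d : ℕ) :
    homogeneousComponent d (ψ ^ d) = (homogeneousComponent 1 ψ) ^ d := by
  induction d with
  | zero => simp
  | succ k ih =>
    rw [pow_succ, pow_succ, aux_top _ hb, ih]
    exact (totalDegree_pow _ _).trans (by nlinarith)

open MvPolynomial in
lemma aux_lin (g : MvPolynomial (Fin 2) ℝ) :
    homogeneousComponent 1 g = C (coeff (Finsupp.single 0 1) g) * X 0
      + C (coeff (Finsupp.single 1 1) g) * X 1 := by
  classical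
  ext n
  by_cases hn : n.degree = 1
  · obtain ⟨i, rfl⟩ : ∃ i, n = Finsupp.single i 1 := by
      have h01 : n 0 + n 1 = 1 := by
        have h := hn
        rwa [Finsupp.degree_eq_sum, Fin.sum_univ_two] at h
      rcases Nat.eq_zero_or_pos (n 0) with h | h
      · refine ⟨1, Finsupp.ext fun j => ?_⟩
        fin_cases j <;> simp <;> omega
      · refine ⟨0, Finsupp.ext fun j => ?_⟩
        fin_cases j <;> simp <;> omega
    rw [coeff_homogeneousComponent, if_pos hn]
    fin_cases i <;> simp [coeff_X, Finsupp.single_left_inj]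
  · rw [coeff_homogeneousComponent, if_neg hn]
    exact ((((isHomogeneous_X _ _).C_mul _).add ((isHomogeneous_X _ _).C_mul _)).coeff_eq_zero
      hn).symm

open Polynomial in
lemma aux_rat (F : ℚ[X]) (hF : F ≠ 0) (d : ℕ) (hd : 1 < d) (hdeg : F.natDegree ≤ d + 1)
    (α : ℝ) (h : (X - C α) ^ d ∣ F.map (algebraMap ℚ ℝ)) : ∃ w : ℚ, (w : ℝ) = α := by
  have hFm : F.map (algebraMap ℚ ℝ) ≠ 0 := by
    simpa [Polynomial.map_eq_zero] using hF
  have hroot : aeval α F = 0 := by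
    have : (X - C α) ∣ F.map (algebraMap ℚ ℝ) := (dvd_pow_self _ (by omega)).trans h
    rw [dvd_iff_isRoot, IsRoot.def, eval_map_algebraMap] at this
    exact this
  have hint : IsIntegral ℚ α := (isAlgebraic_iff_isIntegral.1 ⟨F, hF, hroot⟩)
  have hsep : ((minpoly ℚ α).map (algebraMap ℚ ℝ)).Separable :=
    (minpoly.irreducible hint).separable.map
  have key : ∀ k ≤ d, (minpoly ℚ α) ^ k ∣ F := by
    intro k
    induction k with
    | zero => simp
    | succ k ih =>
      intro hk
      obtain ⟨H, hH⟩ := ih (by omega)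
      have h1 : aeval α H = 0 := by
        by_contra hne
        have hdm : d ≤ rootMultiplicity α (F.map (algebraMap ℚ ℝ)) :=
          (le_rootMultiplicity_iff hFm).2 h
        have h2 : F.map (algebraMap ℚ ℝ) =
          ((minpoly ℚ α).map (algebraMap ℚ ℝ)) ^ k * H.map (algebraMap ℚ ℝ) := by
          conv_lhs => rw [hH]
          simp
        have h3 : rootMultiplicity α (H.map (algebraMap ℚ ℝ)) = 0 := by
          apply rootMultiplicity_eq_zero
          rwa [IsRoot.def, eval_map_algebraMap]
        have h4 := rootMultiplicity_le_one_of_separable hsep α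
        rw [h2] at hdm hFm
        rw [rootMultiplicity_mul hFm, h3, ← count_roots, roots_pow, Multiset.count_nsmul,
          count_roots] at hdm
        nlinarith
      obtain ⟨Q, hQ⟩ := minpoly.dvd ℚ α h1
      exact ⟨Q, by rw [hH, hQ]; ring⟩
  have h5 := natDegree_le_of_dvd (key d le_rfl) hF
  rw [natDegree_pow] at h5
  have h6 : (minpoly ℚ α).natDegree = 1 := by
    have := minpoly.natDegree_pos hint
    by_contra hne
    have : 2 ≤ (minpoly ℚ α).natDegree := by omega
    nlinarith
  obtain ⟨w, hw⟩ := minpoly.natDegree_eq_one_iff.1 h6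
  exact ⟨w, by simpa using hw⟩

open MvPolynomial in
lemma aux_fin (f : MvPolynomial (Fin 2) ℚ) (d : ℕ) (hf : f ≠ 0) (K M u w : ℚ)
    (h : f.map (algebraMap ℚ ℝ) = (C (K : ℝ) * X 0 + C (M : ℝ) * X 1)
      * (C (u : ℝ) * X 0 + C (w : ℝ) * X 1) ^ d) (hd : 1 < d) :
    ∃ (a : ℚ) (g₁' g₂' : MvPolynomial (Fin 2) ℚ),
      g₁'.totalDegree = 1 ∧ g₂'.totalDegree = 1 ∧
      f = MvPolynomial.C a * g₁' * g₂' ^ d := by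
  have h' : f = (C K * X 0 + C M * X 1) * (C u * X 0 + C w * X 1) ^ d := by
    apply map_injective (algebraMap ℚ ℝ) (algebraMap ℚ ℝ).injective
    rw [h]
    simp
  have hom : ∀ a b : ℚ, (C a * X 0 + C b * X 1 : MvPolynomial (Fin 2) ℚ).IsHomogeneous 1 :=
    fun a b => ((isHomogeneous_X _ _).C_mul _).add ((isHomogeneous_X _ _).C_mul _)
  refine ⟨1, _, _, (hom K M).totalDegree ?_, (hom u w).totalDegree ?_, by rw [h']; simp⟩
  · rintro h0
    exact hf (by rw [h', h0, zero_mul])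
  · rintro h0
    exact hf (by rw [h', h0, zero_pow (by omega), mul_zero])

open MvPolynomial in
lemma aux_eval_s2 (f : MvPolynomial (Fin 2) ℚ) (d : ℕ) (p q r s : ℝ)
    (h : f.map (algebraMap ℚ ℝ) = (C p * X 0 + C q * X 1) * (C r * X 0 + C s * X 1) ^ d)
    (x y : ℚ) : ((eval ![x, y] f : ℚ) : ℝ) = (p * x + q * y) * (r * x + s * y) ^ d := by
  have := congrArg (eval ![(x : ℝ), (y : ℝ)]) h
  rw [eval_map] at this
  simp only [map_mul, map_add, map_pow, eval_C, eval_X] at this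
  simp only [Matrix.cons_val_zero, Matrix.cons_val_one] at this
  rw [← this, ← eq_ratCast (algebraMap ℚ ℝ), ← eval₂_id, MvPolynomial.hom_eval₂]
  congr 1
  funext i
  fin_cases i <;> simp

open MvPolynomial in
lemma aux_main (f : MvPolynomial (Fin 2) ℚ) (hf : f ≠ 0) (d : ℕ) (hd : 1 < d) (p q r s : ℝ)
    (h : f.map (algebraMap ℚ ℝ) = (C p * X 0 + C q * X 1) * (C r * X 0 + C s * X 1) ^ d) :
    ∃ (a : ℚ) (g₁' g₂' : MvPolynomial (Fin 2) ℚ),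
      g₁'.totalDegree = 1 ∧ g₂'.totalDegree = 1 ∧
      f = MvPolynomial.C a * g₁' * g₂' ^ d := by
  have hfm : f.map (algebraMap ℚ ℝ) ≠ 0 := by
    rwa [Ne, map_eq_zero_iff _ (map_injective (algebraMap ℚ ℝ) (algebraMap ℚ ℝ).injective)]
  by_cases hr : r = 0
  · subst hr
    have e1 := aux_eval_s2 f d p q 0 s h 1 1
    have e2 := aux_eval_s2 f d p q 0 s h 0 1
    simp at e1 e2
    apply aux_fin f d hf (eval ![1, 1] f - eval ![0, 1] f) (eval ![0, 1] f) 0 1 _ hd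
    rw [h]
    push_cast
    rw [e1, e2]
    simp
    ring
  · have hw : ∃ w : ℚ, (w : ℝ) = - s / r := by
      have hmap : (aeval ![Polynomial.X, 1] f : Polynomial ℚ).map (algebraMap ℚ ℝ)
          = (Polynomial.C p * Polynomial.X + Polynomial.C q)
            * (Polynomial.C r * Polynomial.X + Polynomial.C s) ^ d := by
        have := congrArg (aeval ![(Polynomial.X : Polynomial ℝ), 1]) h
        simp only [map_mul, map_add, map_pow, aeval_X, MvPolynomial.aeval_C] at this
        simp only [Matrix.cons_val_zero, Matrix.cons_val_one, mul_one] at this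
        simp only [Polynomial.algebraMap_eq] at this
        rw [← this, aeval_def, aeval_def, eval₂_map, ← Polynomial.coe_mapRingHom,
          MvPolynomial.hom_eval₂]
        congr 1
        · ext; simp
        · funext i
          fin_cases i <;> simp
      have hL : (Polynomial.C r * Polynomial.X + Polynomial.C s)
          = Polynomial.C r * (Polynomial.X - Polynomial.C (- s / r)) := by
        rw [mul_sub, ← Polynomial.C_mul, mul_div_cancel₀ _ hr]
        simp
      have hpq : Polynomial.C p * Polynomial.X + Polynomial.C q ≠ 0 := by
        intro h0
        have hp := congrArg (Polynomial.coeff · 1) h0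
        have hq := congrArg (Polynomial.coeff · 0) h0
        simp at hp hq
        apply hfm
        rw [h, hp, hq]
        simp
      apply aux_rat (aeval ![Polynomial.X, 1] f : Polynomial ℚ) _ d hd _ (- s / r) _
      · intro h0
        rw [h0, hL] at hmap
        refine absurd hmap.symm ?_
        simp only [Polynomial.map_zero]
        exact mul_ne_zero hpq (pow_ne_zero _ (mul_ne_zero (by simpa using hr)
          (Polynomial.X_sub_C_ne_zero _)))
      · rw [← Polynomial.natDegree_map (algebraMap ℚ ℝ), hmap]
        refine Polynomial.natDegree_mul_le.trans ?_
        have a1 := Polynomial.natDegree_linear_le (a := p) (b := q)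
        have a2 := Polynomial.natDegree_pow_le_of_le d
          (Polynomial.natDegree_linear_le (a := r) (b := s))
        omega
      · rw [hmap, hL, mul_pow]
        exact Dvd.intro_left _ (by rw [mul_assoc])
    obtain ⟨w, hw⟩ := hw
    have hs : s = - (r * w) := by rw [hw]; field_simp
    have e1 := aux_eval_s2 f d p q r s h 1 0
    have e2 := aux_eval_s2 f d p q r s h (w + 1) 1
    have e3 : r * ((w + 1 : ℚ) : ℝ) + s * (1 : ℚ) = r := by rw [hs]; push_cast; ring
    rw [e3] at e2
    simp at e1 e2
    apply aux_fin f d hf (eval ![1, 0] f) (eval ![w + 1, 1] f - eval ![1, 0] f * (w + 1)) 1 (-w) _ hd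
    rw [h]
    push_cast
    rw [e1, e2, hs]
    have : (C r * X 0 + C (-(r * (w:ℝ))) * X 1 : MvPolynomial (Fin 2) ℝ)
      = C r * (C 1 * X 0 + C (-(w:ℝ)) * X 1) := by
      simp only [map_neg, map_mul, map_one]; ring
    rw [this, mul_pow]
    simp only [map_sub, map_add, map_mul, map_pow, map_one]
    ring

theorem rational_factorization_of_linear_mul_power_of_linear
    (f : MvPolynomial (Fin 2) ℚ) (m : ℕ) (hf : f.IsHomogeneous m)
    (d : ℕ) (hd : 1 < d)
    (g₁ g₂ : MvPolynomial (Fin 2) ℝ)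
    (hg₁ : g₁.totalDegree = 1) (hg₂ : g₂.totalDegree = 1)
    (hfact : f.map (algebraMap ℚ ℝ) = g₁ * g₂ ^ d) :
    ∃ (a : ℚ) (g₁' g₂' : MvPolynomial (Fin 2) ℚ),
      g₁'.totalDegree = 1 ∧ g₂'.totalDegree = 1 ∧
      f = MvPolynomial.C a * g₁' * g₂' ^ d := by
  have h1 : g₁ ≠ 0 := by rintro rfl; simp at hg₁
  have h2 : g₂ ≠ 0 := by rintro rfl; simp at hg₂
  have hne : f.map (algebraMap ℚ ℝ) ≠ 0 := by
    rw [hfact]; exact mul_ne_zero h1 (pow_ne_zero _ h2)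
  have hf0 : f ≠ 0 := by rintro rfl; simp at hne
  have hhom := hf.map (algebraMap ℚ ℝ)
  have hp : ∀ k, (g₂ ^ k).totalDegree = k := by
    intro k
    induction k with
    | zero => simp
    | succ k ih =>
      rw [pow_succ, MvPolynomial.totalDegree_mul_of_isDomain (pow_ne_zero _ h2) h2, ih, hg₂]
  have hm : m = 1 + d := by
    rw [← hhom.totalDegree hne, hfact,
      MvPolynomial.totalDegree_mul_of_isDomain h1 (pow_ne_zero _ h2), hp, hg₁]
  subst hm
  have := MvPolynomial.homogeneousComponent_eq_self hhom
  conv_lhs at this => rw [hfact]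
  rw [aux_top hg₁.le (hp d).le, aux_top_pow hg₂.le, aux_lin, aux_lin] at this
  exact aux_main f hf0 d hd _ _ _ _ this.symm
end
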